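/- Let k be a field, A a finitely generated commutative k-algebra, and σ : A → A a k-algebra involution. Let I_A be the ideal of A generated by {a − σ(a) : a ∈ A}, and assume I_A is an invertible ideal (i.e. I_A is a finitely generated projective A-module of rank one). Then A is a finitely generated projective module of rank two over the fixed subring A^σ (i.e. A is finite projective over A^σ and for every prime ideal p of A^σ the localization A_p is a free (A^σ)_p-module of rank 2). -/

import Mathlib

/-- The fixed subring `A^σ` of a ring involution `σ`. -/
def fixedSubring {A : Type*} [CommRing A] (σ : A →+* A) : Subring A where
  carrier := {a | σ a = a}
  mul_mem' := fun {a b} ha hb => by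
    simp only [Set.mem_setOf_eq] at *; rw [map_mul, ha, hb]
  one_mem' := by simp only [Set.mem_setOf_eq, map_one]
  add_mem' := fun {a b} ha hb => by
    simp only [Set.mem_setOf_eq] at *; rw [map_add, ha, hb]
  zero_mem' := by simp only [Set.mem_setOf_eq, map_zero]
  neg_mem' := fun {a} ha => by
    simp only [Set.mem_setOf_eq] at *; rw [map_neg, ha]

/-- The ideal `I_A` of `A` generated by `{a - σ a : a ∈ A}`. -/
def iideal {A : Type*} [CommRing A] (σ : A →+* A) : Ideal A :=
  Ideal.span (Set.range fun a => a - σ a)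

/-- An ideal is invertible if it is a finitely generated projective module of rank one. -/
def IsInvertibleIdeal {A : Type*} [CommRing A] (I : Ideal A) : Prop :=
  Module.Finite A I ∧ Module.Projective A I ∧
    ∀ p : PrimeSpectrum A, Module.rankAtStalk (R := A) I p = 1

section aux
variable {A : Type*} [CommRing A]

lemma aux_equiv (I : Ideal A) (h : IsInvertibleIdeal I) (q : PrimeSpectrum A) :
    Nonempty (LocalizedModule q.asIdeal.primeCompl I ≃ₗ[Localization.AtPrime q.asIdeal]
      Localization.AtPrime q.asIdeal) := by
  obtain ⟨h1, h2, h3⟩ := h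
  have h3 := h3 q
  unfold Module.rankAtStalk at h3
  have : Module.Free (Localization.AtPrime q.asIdeal)
      (LocalizedModule q.asIdeal.primeCompl I) := Module.free_of_flat_of_isLocalRing
  exact ⟨LinearEquiv.ofFinrankEq _ _ (by rw [h3, Module.finrank_self])⟩

lemma aux_faithful (I : Ideal A) (h : IsInvertibleIdeal I) (x : A)
    (hx : ∀ y ∈ I, x * y = 0) : x = 0 := by
  by_contra hne
  have hlt : Ideal.span {x} ≠ ⊥ := by simpa using hne
  have : (Submodule.span A {x}).annihilator ≠ ⊤ := by
    rw [Ne, Submodule.annihilator_eq_top_iff]; exact hlt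
  obtain ⟨m, hm, hle⟩ := Ideal.exists_le_maximal _ this
  obtain ⟨e⟩ := aux_equiv I h ⟨m, hm.isPrime⟩
  have key : algebraMap A (Localization.AtPrime m) x = 0 := by
    have h1 : algebraMap A (Localization.AtPrime m) x • e.symm 1 = 0 := by
      generalize e.symm 1 = w
      induction w using LocalizedModule.induction_on with
      | h y s =>
        rw [algebraMap_smul, LocalizedModule.smul'_mk]
        have : x • y = 0 := Subtype.ext (hx y y.2)
        rw [this, LocalizedModule.zero_mk]
    have h2 := congrArg e h1
    rwa [map_smul, LinearEquiv.apply_symm_apply, smul_eq_mul, mul_one, map_zero] at h2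
  rw [IsLocalization.map_eq_zero_iff m.primeCompl] at key
  obtain ⟨s, hs⟩ := key
  apply s.2
  apply hle
  rw [Submodule.mem_annihilator_span_singleton]
  exact hs

lemma aux_local_gen (S : Set A) (h : IsInvertibleIdeal (Ideal.span S)) (q : PrimeSpectrum A) :
    (∃ d ∈ S, ∃ c, c ∉ q.asIdeal ∧ ∀ y ∈ Ideal.span S, ∃ z, c * y = d * z) := by
  obtain ⟨e⟩ := aux_equiv _ h q
  haveI := h.1
  set R := Localization.AtPrime q.asIdeal
  let mk := LocalizedModule.mkLinearMap q.asIdeal.primeCompl (Ideal.span S)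
  -- some generator is mapped to a unit
  have hex : ∃ d, ∃ hd : d ∈ S, IsUnit (e (mk ⟨d, Ideal.subset_span hd⟩)) := by
    by_contra hcon
    push Not at hcon
    have hall : ∀ y (hy : y ∈ Ideal.span S), e (mk ⟨y, hy⟩) ∈ IsLocalRing.maximalIdeal R := by
      intro y hy
      induction hy using Submodule.span_induction with
      | mem x hx => exact hcon x hx
      | zero =>
        have : (⟨0, Submodule.zero_mem _⟩ : Ideal.span S) = 0 := rfl
        rw [this, map_zero, map_zero]; exact Ideal.zero_mem _
      | add x y hx hy h1 h2 =>
        have : (⟨x + y, Submodule.add_mem _ hx hy⟩ : Ideal.span S) = ⟨x, hx⟩ + ⟨y, hy⟩ := rfl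
        rw [this, map_add, map_add]; exact Ideal.add_mem _ h1 h2
      | smul a x hx h1 =>
        have : (⟨a • x, Submodule.smul_mem _ a hx⟩ : Ideal.span S) = a • ⟨x, hx⟩ := rfl
        rw [this, map_smul, ← algebraMap_smul R a, map_smul]
        exact Ideal.mul_mem_left _ _ h1
    have h1 : e (e.symm 1) ∈ IsLocalRing.maximalIdeal R := by
      generalize e.symm 1 = w
      induction w using LocalizedModule.induction_on with
      | h y s =>
        have : LocalizedModule.mk y s = (Localization.mk 1 s : R) • mk y := by
          simp [mk, LocalizedModule.mkLinearMap_apply, LocalizedModule.mk_smul_mk]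
        rw [this, map_smul]
        exact Ideal.mul_mem_left _ _ (hall y y.2)
    rw [LinearEquiv.apply_symm_apply] at h1
    exact (Ideal.ne_top_iff_one _).1 (IsLocalRing.maximalIdeal.isMaximal R).ne_top h1
  obtain ⟨d, hd, hu⟩ := hex
  refine ⟨d, hd, ?_⟩
  let d' : Ideal.span S := ⟨d, Ideal.subset_span hd⟩
  have hns : q ∉ Module.support A ((Ideal.span S) ⧸ Submodule.span A {d'}) := by
    rw [Module.notMem_support_iff']
    intro m
    obtain ⟨y, rfl⟩ := Submodule.mkQ_surjective _ m
    obtain ⟨u, hu'⟩ := hu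
    have h1 : mk y = ((e (mk y)) * ((u⁻¹ : Rˣ) : R)) • mk d' := by
      apply e.injective
      rw [map_smul, ← hu', smul_eq_mul, mul_assoc, Units.inv_mul, mul_one]
    generalize (e (mk y)) * ((u⁻¹ : Rˣ) : R) = r at h1
    induction r using Localization.induction_on with
    | H as =>
    obtain ⟨a, s⟩ := as
    simp only [mk, LocalizedModule.mkLinearMap_apply, LocalizedModule.mk_smul_mk,
      LocalizedModule.mk_eq, mul_one, one_smul] at h1
    obtain ⟨t, ht⟩ := h1
    refine ⟨(t * s : q.asIdeal.primeCompl), (t * s).2, ?_⟩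
    rw [← map_smul, Submodule.mkQ_apply, Submodule.Quotient.mk_eq_zero,
      Submodule.mem_span_singleton]
    refine ⟨t * a, ?_⟩
    rw [mul_smul]
    simpa [Submonoid.smul_def, mul_smul] using ht.symm
  rw [Module.mem_support_iff_of_finite, SetLike.not_le_iff_exists] at hns
  obtain ⟨c, hc, hcq⟩ := hns
  refine ⟨c, hcq, fun y hy => ?_⟩
  rw [Module.mem_annihilator] at hc
  have := hc (Submodule.Quotient.mk ⟨y, hy⟩)
  rw [← Submodule.Quotient.mk_smul, Submodule.Quotient.mk_eq_zero,
      Submodule.mem_span_singleton] at this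
  obtain ⟨z, hz⟩ := this
  refine ⟨z, ?_⟩
  have := congrArg Subtype.val hz
  simp only [d', Submodule.coe_smul, smul_eq_mul] at this
  rw [← this, mul_comm]

variable (σ : A →+* A)

lemma aux_integral (hσ : ∀ a, σ (σ a) = a) : Algebra.IsIntegral (fixedSubring σ) A := by
  refine ⟨fun x => ?_⟩
  let t : fixedSubring σ := ⟨x + σ x, by show σ _ = _; rw [map_add, hσ, add_comm]⟩
  let n : fixedSubring σ := ⟨x * σ x, by show σ _ = _; rw [map_mul, hσ, mul_comm]⟩
  refine ⟨Polynomial.X ^ 2 + (Polynomial.C (-t) * Polynomial.X + Polynomial.C n), ?_, ?_⟩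
  · apply Polynomial.monic_X_pow_add
    exact lt_of_le_of_lt (Polynomial.degree_linear_le) (by norm_num)
  · simp only [Polynomial.eval₂_add, Polynomial.eval₂_mul, Polynomial.eval₂_pow,
      Polynomial.eval₂_X, Polynomial.eval₂_C]
    show x ^ 2 + (-(x + σ x) * x + x * σ x) = 0
    ring

lemma aux_exists (hσ : ∀ a, σ (σ a) = a) (h : IsInvertibleIdeal (iideal σ))
    (p : Ideal (fixedSubring σ)) [p.IsPrime] :
    ∃ a : A, ∃ b : fixedSubring σ, b ∉ p ∧
      ∀ y ∈ iideal σ, ∃ z, (b : A) * y = (a - σ a) * z := by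
  haveI := aux_integral σ hσ
  obtain ⟨q, -, hq, hqp⟩ := Ideal.exists_ideal_over_prime_of_isIntegral p (⊥ : Ideal A) (by
    intro x hx
    have : (x : A) = 0 := by simpa using hx
    have : x = 0 := Subtype.ext this
    rw [this]; exact Ideal.zero_mem _)
  have hmem : ∀ b : fixedSubring σ, (b : A) ∉ q → b ∉ p := by
    intro b hb hbp
    rw [← hqp] at hbp
    exact hb hbp
  by_cases hx : ∃ x, x - σ x ∉ q
  · obtain ⟨x, hx⟩ := hx
    refine ⟨x, ⟨(x - σ x) * (x - σ x), ?_⟩, hmem _ ?_, fun y _ => ⟨(x - σ x) * y, by ring⟩⟩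
    · show σ _ = _
      simp only [map_mul, map_sub, hσ]; ring
    · exact fun hc => (hq.mem_or_mem hc).elim hx hx
  · push Not at hx
    obtain ⟨d, ⟨a, rfl⟩, c, hc, hcz⟩ := aux_local_gen _ h ⟨q, hq⟩
    refine ⟨a, ⟨c * σ c, ?_⟩, hmem _ ?_, fun y hy => ?_⟩
    · show σ _ = _
      simp only [map_mul, hσ]; ring
    · intro hc'
      rcases hq.mem_or_mem hc' with h1 | h1
      · exact hc h1
      · apply hc
        have := q.add_mem (hx c) h1
        simpa using this
    · obtain ⟨z, hz⟩ := hcz y hy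
      refine ⟨σ c * z, ?_⟩
      simp only at hz ⊢
      linear_combination σ c * hz

lemma aux_maps (hσ : ∀ a, σ (σ a) = a) (h : IsInvertibleIdeal (iideal σ))
    (a : A) (b : fixedSubring σ)
    (hab : ∀ y ∈ iideal σ, ∃ z, (b : A) * y = (a - σ a) * z) :
    ∃ g : A →ₗ[fixedSubring σ] (fixedSubring σ × fixedSubring σ),
      (∀ x : A, (b : A) ^ 2 * x = (g x).1 + (g x).2 * a) ∧
      ∀ u v : fixedSubring σ, g (u + v * a) = (b ^ 2 * u, b ^ 2 * v) := by
  have hb : σ b = b := b.2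
  have hcan : ∀ x y, (a - σ a) * x = (a - σ a) * y → (b : A) * x = b * y := by
    intro x y hxy
    rw [← sub_eq_zero]
    apply aux_faithful _ h
    intro w hw
    obtain ⟨z, hz⟩ := hab w hw
    linear_combination (x - y) * hz + z * hxy
  have hd : ∀ x, x - σ x ∈ iideal σ := fun x => Ideal.subset_span ⟨x, rfl⟩
  choose Y hY using fun x => hab _ (hd x)
  have hfix : ∀ x, (b : A) * σ (Y x) = b * Y x := by
    intro x
    apply hcan
    have := congrArg σ (hY x)
    simp only [map_mul, map_sub, hσ, hb] at this
    linear_combination this + hY x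
  let φ : A →ₗ[fixedSubring σ] fixedSubring σ :=
    { toFun := fun x => ⟨b * Y x, by show σ _ = _; rw [map_mul, hb, hfix]⟩
      map_add' := fun x y => by
        apply Subtype.ext
        show (b : A) * Y (x + y) = b * Y x + b * Y y
        rw [← mul_add]
        apply hcan
        rw [← hY, mul_add, ← hY, ← hY, map_add]; ring
      map_smul' := fun r x => by
        apply Subtype.ext
        show (b : A) * Y ((r : A) * x) = r * (b * Y x)
        have hr : σ r = r := r.2
        rw [mul_left_comm]
        apply hcan
        rw [← hY, mul_left_comm, ← hY, map_mul, hr]; ring }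
  have hφ : ∀ x, ((φ x : fixedSubring σ) : A) = b * Y x := fun x => rfl
  have hψfix : ∀ x, (b : A) ^ 2 * x - φ x * a ∈ fixedSubring σ := by
    intro x
    show σ _ = _
    have h1 : σ (φ x) = φ x := (φ x).2
    simp only [map_sub, map_mul, map_pow, hb, h1]
    rw [hφ]
    linear_combination -(b : A) * hY x
  let ψ : A →ₗ[fixedSubring σ] fixedSubring σ :=
    { toFun := fun x => ⟨_, hψfix x⟩
      map_add' := fun x y => by
        apply Subtype.ext
        show (b : A) ^ 2 * (x + y) - φ (x + y) * a = 
          ((b : A) ^ 2 * x - φ x * a) + ((b : A) ^ 2 * y - φ y * a)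
        rw [map_add, Subring.coe_add]; ring
      map_smul' := fun r x => by
        apply Subtype.ext
        show (b : A) ^ 2 * ((r : A) * x) - φ (r • x) * a = r * ((b : A) ^ 2 * x - φ x * a)
        rw [map_smul, smul_eq_mul, Subring.coe_mul]; ring }
  have hψ : ∀ x, ((ψ x : fixedSubring σ) : A) = (b : A) ^ 2 * x - φ x * a := fun x => rfl
  have hφuv : ∀ u v : fixedSubring σ, φ (u + v * a) = b ^ 2 * v := by
    intro u v
    apply Subtype.ext
    have hu : σ u = u := u.2
    have hv : σ v = v := v.2
    rw [hφ, Subring.coe_mul, Subring.coe_pow, pow_two, mul_assoc]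
    apply hcan
    rw [← hY]
    simp only [map_add, map_mul, hu, hv]
    ring
  refine ⟨ψ.prod φ, fun x => ?_, fun u v => ?_⟩
  · show _ = ((ψ x : fixedSubring σ) : A) + (φ x : fixedSubring σ) * a
    rw [hψ]; ring
  · refine Prod.ext (Subtype.ext ?_) (hφuv u v)
    show ((ψ (u + v * a) : fixedSubring σ) : A) = _
    rw [hψ, hφuv]
    simp only [Subring.coe_mul, Subring.coe_pow]
    ring

/-- The map `(u, v) ↦ u + v a`. -/
def auxF (a : A) : (fixedSubring σ × fixedSubring σ) →ₗ[fixedSubring σ] A :=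
  (LinearMap.toSpanSingleton (fixedSubring σ) A 1).coprod
    (LinearMap.toSpanSingleton (fixedSubring σ) A a)

lemma auxF_apply (a : A) (w : fixedSubring σ × fixedSubring σ) :
    auxF σ a w = w.1 + w.2 * a := by
  simp [auxF, Subring.smul_def]

lemma aux_finproj (hσ : ∀ a, σ (σ a) = a) (h : IsInvertibleIdeal (iideal σ)) :
    Module.Finite (fixedSubring σ) A ∧ Module.Projective (fixedSubring σ) A := by
  let S : Set (fixedSubring σ) := {c | ∃ a : A,
    ∃ g : A →ₗ[fixedSubring σ] (fixedSubring σ × fixedSubring σ),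
      ∀ x, auxF σ a (g x) = c • x}
  have hS : Ideal.span S = ⊤ := by
    by_contra hne
    obtain ⟨m, hm, hle⟩ := Ideal.exists_le_maximal _ hne
    haveI := hm.isPrime
    obtain ⟨a, b, hb, hab⟩ := aux_exists σ hσ h m
    obtain ⟨g, hg, -⟩ := aux_maps σ hσ h a b hab
    have : b ^ 2 ∈ S := ⟨a, g, fun x => by
      rw [auxF_apply, ← hg, Subring.smul_def]; rfl⟩
    exact hb (hm.isPrime.mem_of_pow_mem 2 (hle (Ideal.subset_span this)))
  have h1 : (1 : fixedSubring σ) ∈ Ideal.span S := by rw [hS]; trivial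
  obtain ⟨n, f, c, hf1⟩ := Submodule.mem_span_set'.1 h1
  choose a g hg using fun i => (c i).2
  let G : A →ₗ[fixedSubring σ] (Fin n → fixedSubring σ × fixedSubring σ) :=
    LinearMap.pi fun i => f i • g i
  let F : (Fin n → fixedSubring σ × fixedSubring σ) →ₗ[fixedSubring σ] A :=
    ∑ i, (auxF σ (a i)).comp (LinearMap.proj i)
  have hFG : F.comp G = LinearMap.id := by
    ext x
    simp only [F, G, LinearMap.comp_apply, LinearMap.sum_apply, LinearMap.proj_apply,
      LinearMap.pi_apply, LinearMap.smul_apply, map_smul, hg, LinearMap.id_apply]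
    simp only [smul_smul, ← Finset.sum_smul]
    simp only [smul_eq_mul] at hf1
    rw [hf1, one_smul]
  exact ⟨Module.Finite.of_surjective F (fun x => ⟨G x, LinearMap.congr_fun hFG x⟩),
    Module.Projective.of_split G F hFG⟩

lemma aux_rank (hσ : ∀ a, σ (σ a) = a) (h : IsInvertibleIdeal (iideal σ))
    (p : PrimeSpectrum (fixedSubring σ)) :
    Nonempty (LocalizedModule p.asIdeal.primeCompl (fixedSubring σ × fixedSubring σ)
      ≃ₗ[Localization.AtPrime p.asIdeal] LocalizedModule p.asIdeal.primeCompl A) := by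
  obtain ⟨a, b, hb, hab⟩ := aux_exists σ hσ h p.asIdeal
  obtain ⟨g, hg, hg'⟩ := aux_maps σ hσ h a b hab
  have hb2 : b ^ 2 ∈ p.asIdeal.primeCompl := fun hc => hb (p.2.mem_of_pow_mem 2 hc)
  have e1 : ∀ x, auxF σ a (g x) = b ^ 2 • x := fun x => by
    rw [auxF_apply, ← hg, Subring.smul_def]; rfl
  have e2 : ∀ w, g (auxF σ a w) = b ^ 2 • w := fun w => by
    rw [auxF_apply, hg']; rfl
  let L := LocalizedModule.map p.asIdeal.primeCompl (auxF σ a)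
  refine ⟨LinearEquiv.ofBijective L ⟨?_, ?_⟩⟩
  · rw [← LinearMap.ker_eq_bot, LinearMap.ker_eq_bot']
    intro m hm
    induction m using LocalizedModule.induction_on with
    | h w s =>
    rw [LocalizedModule.map_mk, ← LocalizedModule.zero_mk s, LocalizedModule.mk_eq] at hm
    obtain ⟨t, ht⟩ := hm
    rw [← LocalizedModule.zero_mk s, LocalizedModule.mk_eq]
    refine ⟨t * ⟨b ^ 2, hb2⟩, ?_⟩
    simp only [smul_zero, Submonoid.smul_def] at ht ⊢
    have := congrArg g ht
    simp only [map_smul, e2, map_zero] at this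
    rw [← this]
    simp only [smul_smul, Submonoid.coe_mul]
    congr 1; ring
  · intro m
    induction m using LocalizedModule.induction_on with
    | h x s =>
    refine ⟨LocalizedModule.mk (g x) (s * ⟨b ^ 2, hb2⟩), ?_⟩
    rw [LocalizedModule.map_mk, e1, LocalizedModule.mk_eq]
    refine ⟨1, ?_⟩
    simp only [Submonoid.smul_def, smul_smul, Submonoid.coe_mul, Submonoid.coe_one]

end aux

/-- If `(A, σ)` is a pure involution of a finitely generated algebra over a field `k`
(`I_A` is an invertible ideal), then `A` is a finitely generated projective module of rank
two over the fixed subring `A^σ`. -/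
theorem pure_involution_flat_of_rank_two
    {k : Type*} [Field k] {A : Type*} [CommRing A] [Algebra k A] [Algebra.FiniteType k A]
    (σ : A →ₐ[k] A) (hσ : ∀ a : A, σ (σ a) = a)
    (hpure : IsInvertibleIdeal (iideal σ.toRingHom)) :
    Module.Finite (fixedSubring σ.toRingHom) A ∧
      Module.Projective (fixedSubring σ.toRingHom) A ∧
      ∀ p : PrimeSpectrum (fixedSubring σ.toRingHom),
        Module.Free (Localization.AtPrime p.asIdeal)
            (LocalizedModule p.asIdeal.primeCompl A) ∧
          Module.rankAtStalk (R := fixedSubring σ.toRingHom) A p = 2 := by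
  have h1 := aux_finproj σ.toRingHom hσ hpure
  obtain ⟨hf, hp⟩ := h1
  refine ⟨hf, hp, fun p => ?_⟩
  obtain ⟨e⟩ := aux_rank σ.toRingHom hσ hpure p
  refine ⟨Module.free_of_flat_of_isLocalRing, ?_⟩
  have h2 : Module.rankAtStalk (R := fixedSubring σ.toRingHom)
      (fixedSubring σ.toRingHom × fixedSubring σ.toRingHom) p = 2 := by
    haveI : Nontrivial (fixedSubring σ.toRingHom) := p.nontrivial
    rw [Module.rankAtStalk_eq_finrank_of_free]
    rw [Module.finrank_prod, Module.finrank_self]; rfl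
  rw [← h2]
  exact (LinearEquiv.finrank_eq e).symm
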